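/- Let M ⊆ F be a finitely generated graded A-module whose initial module in_{(ω,ε)}(M) is componentwise linear. If β_0(M) = β_0(in_{(ω,ε)}(M)) (equal numbers of minimal generators), then M is componentwise linear. -/

import Mathlib

/-!  Basic setup: the polynomial ring `A = K[X_1,…,X_n]`, a graded free module
`F = ⊕_{j} A(-d_j)` realized as `Fin k → A`, weight orders `(ω, ε)`, initial
modules, Hilbert functions, graded free resolutions, Betti numbers,
regularity and componentwise notions, following Caviglia–Varbaro,
"Componentwise regularity (I)". -/

namespace CregPaper

abbrev A (K : Type*) [Field K] (n : ℕ) := MvPolynomial (Fin n) K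

variable {K : Type*} [Field K] {n k : ℕ}

/-- `(ω)`-weight of an exponent vector `u`. -/
def wdeg (ω : Fin n → ℕ) (u : Fin n →₀ ℕ) : ℕ := u.sum fun i e => ω i * e

/-- total (standard) degree of an exponent vector `u`. -/
def tdeg (u : Fin n →₀ ℕ) : ℕ := u.sum fun _ e => e

/-- largest `(ω,ε)`-weight of a monomial in the support of `f ∈ F`. -/
noncomputable def maxWt (ω : Fin n → ℕ) (ε : Fin k → ℕ) (f : Fin k → A K n) : ℕ :=
  Finset.univ.sup fun j => (f j).support.sup fun u => wdeg ω u + ε j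

/-- the initial part `in_{(ω,ε)}(f)`: the sum of the terms of `f` of largest weight. -/
noncomputable def inForm (ω : Fin n → ℕ) (ε : Fin k → ℕ) (f : Fin k → A K n) :
    Fin k → A K n :=
  fun j => ∑ u ∈ (f j).support.filter fun u => wdeg ω u + ε j = maxWt ω ε f,
    MvPolynomial.monomial u ((f j).coeff u)

/-- the initial module `in_{(ω,ε)}(M)`. -/
noncomputable def inMod (ω : Fin n → ℕ) (ε : Fin k → ℕ)
    (M : Submodule (A K n) (Fin k → A K n)) : Submodule (A K n) (Fin k → A K n) :=
  Submodule.span (A K n) {g | ∃ f ∈ M, f ≠ 0 ∧ g = inForm ω ε f}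

/-- `f ∈ F = ⊕_j A(-d_j)` is homogeneous of (standard) degree `a`. -/
def IsHomog (d : Fin k → ℕ) (a : ℕ) (f : Fin k → A K n) : Prop :=
  ∀ j, ∀ u ∈ (f j).support, tdeg u + d j = a

/-- the `K`-subspace of `F` of homogeneous elements of degree `a`. -/
noncomputable def homogSub (d : Fin k → ℕ) (a : ℕ) : Submodule K (Fin k → A K n) where
  carrier := {f | IsHomog d a f}
  add_mem' := by
    intro f g hf hg j u hu
    rcases Finset.mem_union.mp (MvPolynomial.support_add hu) with h | h
    · exact hf j u h
    · exact hg j u h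
  zero_mem' := by intro j u hu; simp at hu
  smul_mem' := by
    intro c f hf j u hu
    exact hf j u (MvPolynomial.support_smul hu)

/-- the degree-`a` homogeneous component of `f ∈ F`. -/
noncomputable def homogComp (d : Fin k → ℕ) (f : Fin k → A K n) (a : ℕ) : Fin k → A K n :=
  fun j => ∑ u ∈ (f j).support.filter fun u => tdeg u + d j = a,
    MvPolynomial.monomial u ((f j).coeff u)

/-- `M ⊆ F` is a graded submodule. -/
def IsGradedSub (d : Fin k → ℕ) (M : Submodule (A K n) (Fin k → A K n)) : Prop :=
  ∀ f ∈ M, ∀ a, homogComp d f a ∈ M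

/-- Hilbert function of `M ⊆ F` in degree `a`. -/
noncomputable def hilb (d : Fin k → ℕ) (M : Submodule (A K n) (Fin k → A K n)) (a : ℕ) : ℕ :=
  Module.finrank K ↥(Submodule.restrictScalars K M ⊓ homogSub d a)

/-- the homogeneous maximal ideal `m = (X_1,…,X_n)` of `A`. -/
noncomputable def mIdeal (K : Type*) [Field K] (n : ℕ) : Ideal (A K n) :=
  RingHom.ker (MvPolynomial.constantCoeff : A K n →+* K)

/-- graded Betti number `β_{0,a}(M) = dim_K (M/mM)_a`, the number of minimal
generators of the graded module `M` in degree `a`. -/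
noncomputable def beta0 (d : Fin k → ℕ) (M : Submodule (A K n) (Fin k → A K n)) (a : ℕ) : ℕ :=
  hilb d M a - hilb d (mIdeal K n • M) a

/-- A graded free resolution of a graded submodule `M` of `F = ⊕_j A(-d_j)`:
`⋯ → A^{rk 1} → A^{rk 0} → M → 0`, each free module coming with degree shifts
`sh i`, all maps graded of degree `0`. -/
structure GFRes (d : Fin k → ℕ) (M : Submodule (A K n) (Fin k → A K n)) where
  rk : ℕ → ℕ
  sh : (i : ℕ) → Fin (rk i) → ℕ
  aug : (Fin (rk 0) → A K n) →ₗ[A K n] (Fin k → A K n)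
  diff : (i : ℕ) → ((Fin (rk (i+1)) → A K n) →ₗ[A K n] (Fin (rk i) → A K n))
  aug_range : LinearMap.range aug = M
  aug_hom : ∀ l, IsHomog d (sh 0 l) (aug (Pi.single l 1))
  diff_hom : ∀ i l, IsHomog (sh i) (sh (i+1) l) (diff i (Pi.single l 1))
  ex0 : LinearMap.range (diff 0) = LinearMap.ker aug
  exs : ∀ i, LinearMap.range (diff (i+1)) = LinearMap.ker (diff i)

/-- minimality of a graded free resolution: all entries of the differential
matrices lie in the maximal ideal. -/
def GFRes.Minimal {d : Fin k → ℕ} {M : Submodule (A K n) (Fin k → A K n)}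
    (res : GFRes d M) : Prop :=
  ∀ i x l, res.diff i x l ∈ mIdeal K n

/-- the graded Betti number `β_{i,j}(M)` read off from a (minimal) resolution. -/
noncomputable def GFRes.betti {d : Fin k → ℕ} {M : Submodule (A K n) (Fin k → A K n)}
    (res : GFRes d M) (i j : ℕ) : ℕ :=
  (Finset.univ.filter fun l => res.sh i l = j).card

/-- `reg_A(M) ≤ r`: there is a minimal graded free resolution of `M` with
all shifts in homological degree `i` bounded by `i + r`. -/
def RegLE (d : Fin k → ℕ) (M : Submodule (A K n) (Fin k → A K n)) (r : ℕ) : Prop :=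
  ∃ res : GFRes d M, res.Minimal ∧ ∀ i l, res.sh i l ≤ i + r

/-- `M_{⟨a⟩}`: the submodule generated by the homogeneous elements of degree `a` of `M`. -/
noncomputable def compSub (d : Fin k → ℕ) (M : Submodule (A K n) (Fin k → A K n)) (a : ℕ) :
    Submodule (A K n) (Fin k → A K n) :=
  Submodule.span (A K n) {f | f ∈ M ∧ IsHomog d a f}

/-- `M` is `r`-componentwise regular: `reg (M_{⟨a⟩}) ≤ a + r` for all `a`. -/
def CWRegLE (d : Fin k → ℕ) (M : Submodule (A K n) (Fin k → A K n)) (r : ℕ) : Prop :=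
  ∀ a, RegLE d (compSub d M a) (a + r)

/-- `M` is componentwise linear: each `M_{⟨a⟩}` is zero or has regularity `a`. -/
def CompLinear (d : Fin k → ℕ) (M : Submodule (A K n) (Fin k → A K n)) : Prop :=
  ∀ a, compSub d M a = ⊥ ∨ RegLE d (compSub d M a) a

/-- `M` is generated in degrees `≤ a`. -/
def GenInDegLE (d : Fin k → ℕ) (M : Submodule (A K n) (Fin k → A K n)) (a : ℕ) : Prop :=
  M ≤ Submodule.span (A K n) {f | f ∈ M ∧ ∃ b ≤ a, IsHomog d b f}

end CregPaper

namespace CregPaper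

section Components

variable {K : Type*} [Field K] {n k r : ℕ}

theorem wdeg_add (ω : Fin n → ℕ) (u v : Fin n →₀ ℕ) :
    wdeg ω (u + v) = wdeg ω u + wdeg ω v :=
  Finsupp.sum_add_index' (by simp) (by intros; ring)

theorem wdeg_zero (ω : Fin n → ℕ) : wdeg ω 0 = 0 := Finsupp.sum_zero_index

theorem tdeg_eq_wdeg_one (u : Fin n →₀ ℕ) : tdeg u = wdeg 1 u := by
  simp [tdeg, wdeg]

theorem eq_zero_of_wdeg_one {u : Fin n →₀ ℕ} (h : wdeg 1 u = 0) : u = 0 := by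
  rw [← tdeg_eq_wdeg_one] at h
  ext i
  simpa using congrFun (show (u : Fin n → ℕ) = 0 by
    simpa [tdeg, Finsupp.sum, funext_iff] using h) i

theorem mem_mIdeal {p : A K n} : p ∈ mIdeal K n ↔ p.coeff 0 = 0 := by
  rw [mIdeal, RingHom.mem_ker, MvPolynomial.constantCoeff_eq]

/-- The weight-`w` component of an element of the free module, as a `K`-linear map. -/
noncomputable def comp (ω : Fin n → ℕ) (ε : Fin k → ℕ) (w : ℕ) :
    (Fin k → A K n) →ₗ[K] (Fin k → A K n) where
  toFun f := fun j => ∑ u ∈ (f j).support.filter fun u => wdeg ω u + ε j = w,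
    MvPolynomial.monomial u ((f j).coeff u)
  map_add' f g := by
    ext j u
    simp only [MvPolynomial.coeff_sum, MvPolynomial.coeff_monomial, Pi.add_apply,
      MvPolynomial.coeff_add, Finset.sum_ite_eq', Finset.mem_filter, MvPolynomial.mem_support_iff]
    split_ifs <;> simp_all
  map_smul' c f := by
    ext j u
    simp only [MvPolynomial.coeff_sum, MvPolynomial.coeff_monomial, Pi.smul_apply,
      MvPolynomial.coeff_smul, Finset.sum_ite_eq', Finset.mem_filter,
      MvPolynomial.mem_support_iff, RingHom.id_apply]
    split_ifs <;> simp_all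

theorem coeff_comp (ω : Fin n → ℕ) (ε : Fin k → ℕ) (w : ℕ) (f : Fin k → A K n) (j : Fin k)
    (u : Fin n →₀ ℕ) :
    (comp ω ε w f j).coeff u = if wdeg ω u + ε j = w then (f j).coeff u else 0 := by
  simp only [comp, LinearMap.coe_mk, AddHom.coe_mk, MvPolynomial.coeff_sum,
    MvPolynomial.coeff_monomial, Finset.sum_ite_eq', Finset.mem_filter,
    MvPolynomial.mem_support_iff]
  split_ifs <;> simp_all

theorem inForm_eq_comp (ω : Fin n → ℕ) (ε : Fin k → ℕ) (f : Fin k → A K n) :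
    inForm ω ε f = comp ω ε (maxWt ω ε f) f := rfl

theorem homogComp_eq_comp (d : Fin k → ℕ) (f : Fin k → A K n) (a : ℕ) :
    homogComp d f a = comp 1 d a f := by
  funext j
  simp [homogComp, comp, tdeg_eq_wdeg_one]

theorem isGradedSub_iff {d : Fin k → ℕ} {M : Submodule (A K n) (Fin k → A K n)} :
    IsGradedSub d M ↔ ∀ f ∈ M, ∀ a, comp 1 d a f ∈ M := by
  simp only [IsGradedSub, homogComp_eq_comp]

/-- `f` is homogeneous of weight `w`. -/
def Homog (ω : Fin n → ℕ) (ε : Fin k → ℕ) (w : ℕ) (f : Fin k → A K n) : Prop :=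
  ∀ j u, (f j).coeff u ≠ 0 → wdeg ω u + ε j = w

theorem isHomog_iff {d : Fin k → ℕ} {a : ℕ} {f : Fin k → A K n} :
    IsHomog d a f ↔ Homog 1 d a f := by
  simp [IsHomog, Homog, tdeg_eq_wdeg_one]

/-- The `K`-subspace of elements all of whose terms have weight less than `w`. -/
def wtLT (K : Type*) [Field K] (ω : Fin n → ℕ) (ε : Fin k → ℕ) (w : ℕ) :
    Submodule K (Fin k → A K n) where
  carrier := {f | ∀ j u, (f j).coeff u ≠ 0 → wdeg ω u + ε j < w}
  add_mem' := by
    intro f g hf hg j u hu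
    by_cases h : (f j).coeff u = 0
    · exact hg j u fun h' => hu (by simp [h, h'])
    · exact hf j u h
  zero_mem' := by intro j u hu; simp at hu
  smul_mem' := by
    intro c f hf j u hu
    exact hf j u fun h => hu (by simp [h])

variable {ω η : Fin n → ℕ} {ε δ : Fin k → ℕ} {v w : ℕ} {f g : Fin k → A K n}

theorem mem_wtLT : f ∈ wtLT K ω ε w ↔ ∀ j u, (f j).coeff u ≠ 0 → wdeg ω u + ε j < w := Iff.rfl

theorem wtLT_mono (h : v ≤ w) : wtLT K ω ε v ≤ wtLT K ω ε w :=
  fun _ hf j u hu => (hf j u hu).trans_le h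

theorem eq_zero_of_mem_wtLT_zero (h : f ∈ wtLT K ω ε 0) : f = 0 := by
  ext j u
  by_contra hu
  exact absurd (h j u hu) (by simp)

theorem mem_wtLT_maxWt (ω : Fin n → ℕ) (ε : Fin k → ℕ) (f : Fin k → A K n) :
    f ∈ wtLT K ω ε (maxWt ω ε f + 1) := by
  intro j u hu
  rw [Nat.lt_succ_iff]
  exact (Finset.le_sup (f := fun u => wdeg ω u + ε j) (MvPolynomial.mem_support_iff.2 hu)).trans
    (Finset.le_sup (f := fun j => (f j).support.sup fun u => wdeg ω u + ε j) (Finset.mem_univ j))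

theorem maxWt_le (h : f ∈ wtLT K ω ε (w + 1)) : maxWt ω ε f ≤ w := by
  simp only [maxWt, Finset.sup_le_iff]
  intro j _ u hu
  exact Nat.lt_succ_iff.1 (h j u (MvPolynomial.mem_support_iff.1 hu))

theorem homog_comp (ω : Fin n → ℕ) (ε : Fin k → ℕ) (w : ℕ) (f : Fin k → A K n) :
    Homog ω ε w (comp ω ε w f) := by
  intro j u hu
  rw [coeff_comp] at hu
  by_contra h
  simp [h] at hu

theorem Homog.comp (h : Homog η δ v f) (ω : Fin n → ℕ) (ε : Fin k → ℕ) (w : ℕ) :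
    Homog η δ v (comp ω ε w f) := by
  intro j u hu
  rw [coeff_comp] at hu
  exact h j u fun h => hu (by simp [h])

theorem comp_mem_wtLT (h : f ∈ wtLT K η δ v) (ω : Fin n → ℕ) (ε : Fin k → ℕ) (w : ℕ) :
    comp ω ε w f ∈ wtLT K η δ v := by
  intro j u hu
  rw [coeff_comp] at hu
  exact h j u fun h => hu (by simp [h])

theorem Homog.mem_wtLT (h : Homog ω ε w f) : f ∈ wtLT K ω ε (w + 1) :=
  fun j u hu => Nat.lt_succ_iff.2 (h j u hu).le

theorem Homog.comp_eq (h : Homog ω ε w f) : CregPaper.comp ω ε w f = f := by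
  ext j u
  rw [coeff_comp]
  by_cases hu : (f j).coeff u = 0
  · simp [hu]
  · rw [if_pos (h j u hu)]

theorem Homog.comp_eq_zero (h : Homog ω ε w f) (hv : v ≠ w) : CregPaper.comp ω ε v f = 0 := by
  ext j u
  rw [coeff_comp]
  by_cases hu : (f j).coeff u = 0
  · simp [hu]
  · rw [if_neg]
    · simp
    · rw [h j u hu]; exact hv.symm

theorem comp_comm (ω η : Fin n → ℕ) (ε δ : Fin k → ℕ) (v w : ℕ) (f : Fin k → A K n) :
    comp ω ε w (comp η δ v f) = comp η δ v (comp ω ε w f) := by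
  ext j u
  simp only [coeff_comp]
  split_ifs <;> rfl

theorem comp_idem (ω : Fin n → ℕ) (ε : Fin k → ℕ) (w : ℕ) (f : Fin k → A K n) :
    comp ω ε w (comp ω ε w f) = comp ω ε w f :=
  (homog_comp ω ε w f).comp_eq

theorem comp_eq_zero_of_mem_wtLT (h : f ∈ wtLT K ω ε w) : comp ω ε w f = 0 := by
  ext j u
  rw [coeff_comp]
  by_cases hu : (f j).coeff u = 0
  · simp [hu]
  · rw [if_neg (h j u hu).ne]; simp

theorem mem_wtLT_of_comp_eq_zero (h : f ∈ wtLT K ω ε (w + 1)) (h0 : comp ω ε w f = 0) :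
    f ∈ wtLT K ω ε w := by
  intro j u hu
  refine lt_of_le_of_ne (Nat.lt_succ_iff.1 (h j u hu)) fun hw => hu ?_
  have := coeff_comp ω ε w f j u
  rw [h0, if_pos hw] at this
  simpa using this.symm

theorem eq_zero_of_forall_comp_eq_zero (ω : Fin n → ℕ) (ε : Fin k → ℕ)
    (h : ∀ w, f ∈ wtLT K ω ε (w + 1) → comp ω ε w f = 0) : f = 0 := by
  have key : ∀ w, f ∈ wtLT K ω ε w → f = 0 := by
    intro w
    induction w with
    | zero => exact eq_zero_of_mem_wtLT_zero
    | succ w ih => exact fun hw => ih (mem_wtLT_of_comp_eq_zero hw (h w hw))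
  exact key _ (mem_wtLT_maxWt ω ε f)

theorem sum_comp (h : f ∈ wtLT K ω ε w) : ∑ v ∈ Finset.range w, comp ω ε v f = f := by
  ext j u
  simp only [Finset.sum_apply, MvPolynomial.coeff_sum, coeff_comp, Finset.sum_ite_eq,
    Finset.mem_range]
  by_cases hu : (f j).coeff u = 0
  · simp [hu]
  · rw [if_pos (h j u hu)]

theorem mem_of_comp_mem (ω : Fin n → ℕ) (ε : Fin k → ℕ) {N : Submodule (A K n) (Fin k → A K n)}
    (h : ∀ w, comp ω ε w f ∈ N) : f ∈ N := by
  rw [← sum_comp (mem_wtLT_maxWt ω ε f)]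
  exact sum_mem fun w _ => h w

theorem monomial_smul_mem_wtLT (h : f ∈ wtLT K ω ε w) (u : Fin n →₀ ℕ) (c : K) :
    (MvPolynomial.monomial u c : A K n) • f ∈ wtLT K ω ε (wdeg ω u + w) := by
  intro j s hs
  simp only [Pi.smul_apply, smul_eq_mul, MvPolynomial.coeff_monomial_mul'] at hs
  split_ifs at hs with hle
  · have := h j (s - u) (right_ne_zero_of_mul hs)
    rw [← add_tsub_cancel_of_le hle, wdeg_add]
    omega
  · simp at hs

theorem Homog.monomial_smul (h : Homog ω ε w f) (u : Fin n →₀ ℕ) (c : K) :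
    Homog ω ε (wdeg ω u + w) ((MvPolynomial.monomial u c : A K n) • f) := by
  intro j s hs
  simp only [Pi.smul_apply, smul_eq_mul, MvPolynomial.coeff_monomial_mul'] at hs
  split_ifs at hs with hle
  · have := h j (s - u) (right_ne_zero_of_mul hs)
    rw [← add_tsub_cancel_of_le hle, wdeg_add]
    omega
  · simp at hs

theorem comp_monomial_smul (ω : Fin n → ℕ) (ε : Fin k → ℕ) (w : ℕ) (f : Fin k → A K n)
    (u : Fin n →₀ ℕ) (c : K) :
    comp ω ε (wdeg ω u + w) ((MvPolynomial.monomial u c : A K n) • f) =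
      (MvPolynomial.monomial u c : A K n) • comp ω ε w f := by
  ext j s
  simp only [coeff_comp, Pi.smul_apply, smul_eq_mul, MvPolynomial.coeff_monomial_mul']
  by_cases hle : u ≤ s
  · have : wdeg ω s = wdeg ω u + wdeg ω (s - u) := by
      rw [← wdeg_add, add_tsub_cancel_of_le hle]
    simp only [hle, if_true, this, add_assoc, add_right_inj, mul_ite, mul_zero]
  · simp [hle]

theorem comp_monomial_smul_of_lt (u : Fin n →₀ ℕ) (c : K) (hw : w < wdeg ω u) :
    comp ω ε w ((MvPolynomial.monomial u c : A K n) • f) = 0 := by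
  ext j s
  simp only [coeff_comp, Pi.smul_apply, smul_eq_mul, MvPolynomial.coeff_monomial_mul']
  by_cases hle : u ≤ s
  · have : wdeg ω s = wdeg ω u + wdeg ω (s - u) := by
      rw [← wdeg_add, add_tsub_cancel_of_le hle]
    rw [if_neg (by omega)]; simp
  · simp [hle]

theorem homog_single (ε : Fin k → ℕ) (ω : Fin n → ℕ) (l : Fin k) :
    Homog ω ε (ε l) (Pi.single l 1 : Fin k → A K n) := by
  intro j u hu
  rcases eq_or_ne j l with rfl | hj
  · rw [Pi.single_eq_same, MvPolynomial.coeff_one] at hu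
    have : u = 0 := by by_contra h; exact hu (if_neg (Ne.symm h))
    simp [this, wdeg_zero]
  · simp [Pi.single_eq_of_ne hj] at hu

theorem eq_sum_monomial_smul (x : Fin r → A K n) :
    x = ∑ l, ∑ u ∈ (x l).support,
      (MvPolynomial.monomial u ((x l).coeff u) : A K n) • (Pi.single l 1 : Fin r → A K n) := by
  conv_lhs => rw [pi_eq_sum_univ' x]
  refine Finset.sum_congr rfl fun l _ => ?_
  rw [← Finset.sum_smul, ← MvPolynomial.as_sum]

variable {ε' : Fin r → ℕ} {φ : (Fin r → A K n) →ₗ[A K n] (Fin k → A K n)}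

theorem map_comp (hφ : ∀ l, Homog ω ε (ε' l) (φ (Pi.single l 1))) (w : ℕ) (x : Fin r → A K n) :
    φ (comp ω ε' w x) = comp ω ε w (φ x) := by
  rw [eq_sum_monomial_smul x]
  simp only [map_sum, map_smul]
  refine Finset.sum_congr rfl fun l _ => Finset.sum_congr rfl fun u _ => ?_
  have h1 := (homog_single (K := K) ε' ω l).monomial_smul u ((x l).coeff u)
  have h2 := (hφ l).monomial_smul u ((x l).coeff u)
  by_cases hw : w = wdeg ω u + ε' l
  · subst hw
    rw [h1.comp_eq, h2.comp_eq, map_smul]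
  · rw [h1.comp_eq_zero hw, h2.comp_eq_zero hw, map_zero]

theorem Homog.map (hφ : ∀ l, Homog ω ε (ε' l) (φ (Pi.single l 1))) {x : Fin r → A K n}
    (hx : Homog ω ε' w x) : Homog ω ε w (φ x) := by
  rw [← hx.comp_eq, map_comp hφ]
  exact homog_comp _ _ _ _

theorem map_mem_wtLT {c : ℕ} (hφ : ∀ l, φ (Pi.single l 1) ∈ wtLT K ω ε (ε' l + c))
    {x : Fin r → A K n} (hx : x ∈ wtLT K ω ε' (w + 1)) : φ x ∈ wtLT K ω ε (w + c) := by
  rw [eq_sum_monomial_smul x]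
  simp only [map_sum, map_smul]
  refine sum_mem fun l _ => sum_mem fun u hu => ?_
  refine wtLT_mono ?_ (monomial_smul_mem_wtLT (hφ l) u _)
  have := hx l u (MvPolynomial.mem_support_iff.1 hu)
  omega

end Components

end CregPaper

namespace CregPaper

section InitialModules

variable {K : Type*} [Field K] {n k r : ℕ}

/-- The linear map `A^r → F` sending the `l`-th basis vector to `f l`. -/
noncomputable abbrev genMap (f : Fin r → Fin k → A K n) :
    (Fin r → A K n) →ₗ[A K n] (Fin k → A K n) :=
  Fintype.linearCombination (A K n) f

theorem genMap_single (f : Fin r → Fin k → A K n) (l : Fin r) :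
    genMap f (Pi.single l 1) = f l := by
  rw [genMap, Fintype.linearCombination_apply_single, one_smul]

theorem genMap_mem {f : Fin r → Fin k → A K n} {N : Submodule (A K n) (Fin k → A K n)}
    (h : ∀ l, f l ∈ N) (x : Fin r → A K n) : genMap f x ∈ N := by
  rw [genMap, Fintype.linearCombination_apply]
  exact sum_mem fun l _ => N.smul_mem _ (h l)

variable {ω : Fin n → ℕ} {ε d : Fin k → ℕ} {ε' sh : Fin r → ℕ}
  {M N : Submodule (A K n) (Fin k → A K n)} {f : Fin r → Fin k → A K n}

theorem mem_inMod_iff {h : Fin k → A K n} :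
    h ∈ inMod ω ε M ↔
      ∀ w, ∃ g ∈ M, g ∈ wtLT K ω ε (w + 1) ∧ comp ω ε w g = comp ω ε w h := by
  constructor
  · intro hh
    induction hh using Submodule.span_induction with
    | mem h hh =>
      obtain ⟨f, hf, -, rfl⟩ := hh
      intro w
      rw [inForm_eq_comp]
      by_cases hw : w = maxWt ω ε f
      · subst hw
        exact ⟨f, hf, mem_wtLT_maxWt _ _ _, (comp_idem _ _ _ _).symm⟩
      · refine ⟨0, M.zero_mem, zero_mem _, ?_⟩
        rw [(homog_comp ω ε _ f).comp_eq_zero hw, map_zero]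
    | zero => exact fun w => ⟨0, M.zero_mem, zero_mem _, rfl⟩
    | add x y _ _ hx hy =>
      intro w
      obtain ⟨g, hg, hg', hgw⟩ := hx w
      obtain ⟨g₂, hg₂, hg₂', hgw₂⟩ := hy w
      exact ⟨g + g₂, add_mem hg hg₂, add_mem hg' hg₂', by rw [map_add, map_add, hgw, hgw₂]⟩
    | smul p x _ hx =>
      induction p using MvPolynomial.induction_on' with
      | monomial u c =>
        intro w
        by_cases hw : w < wdeg ω u
        · refine ⟨0, M.zero_mem, zero_mem _, ?_⟩
          rw [comp_monomial_smul_of_lt u c hw, map_zero]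
        · obtain ⟨v, rfl⟩ := exists_add_of_le (not_lt.1 hw)
          obtain ⟨g, hg, hg', hgv⟩ := hx v
          refine ⟨MvPolynomial.monomial u c • g, M.smul_mem _ hg,
            monomial_smul_mem_wtLT hg' u c, ?_⟩
          rw [comp_monomial_smul, comp_monomial_smul, hgv]
      | add p q hp hq =>
        intro w
        obtain ⟨g, hg, hg', hgw⟩ := hp w
        obtain ⟨g₂, hg₂, hg₂', hgw₂⟩ := hq w
        refine ⟨g + g₂, add_mem hg hg₂, add_mem hg' hg₂', ?_⟩
        rw [add_smul, map_add, map_add, hgw, hgw₂]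
  · intro hh
    refine mem_of_comp_mem ω ε fun w => ?_
    obtain ⟨g, hg, hg', hgw⟩ := hh w
    rw [← hgw]
    by_cases h0 : comp ω ε w g = 0
    · rw [h0]; exact zero_mem _
    refine Submodule.subset_span ⟨g, hg, fun h => h0 (by rw [h, map_zero]), ?_⟩
    have : maxWt ω ε g = w := by
      refine le_antisymm (maxWt_le hg') ?_
      by_contra hlt
      exact h0 (comp_eq_zero_of_mem_wtLT (wtLT_mono (by omega) (mem_wtLT_maxWt ω ε g)))
    rw [inForm_eq_comp, this]

theorem comp_mem_inMod {g : Fin k → A K n} {w : ℕ} (hg : g ∈ M) (hg' : g ∈ wtLT K ω ε (w + 1)) :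
    comp ω ε w g ∈ inMod ω ε M := by
  refine mem_inMod_iff.2 fun v => ?_
  by_cases hv : v = w
  · subst hv
    exact ⟨g, hg, hg', (comp_idem _ _ _ _).symm⟩
  · exact ⟨0, zero_mem _, zero_mem _, by rw [(homog_comp ω ε w g).comp_eq_zero hv, map_zero]⟩

theorem exists_homog_of_mem_inMod (hM : IsGradedSub d M) {h : Fin k → A K n} {a : ℕ}
    (hh : h ∈ inMod ω ε M) (ha : Homog 1 d a h) (w : ℕ) :
    ∃ g ∈ M, Homog 1 d a g ∧ g ∈ wtLT K ω ε (w + 1) ∧ comp ω ε w g = comp ω ε w h := by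
  obtain ⟨g, hg, hg', hgw⟩ := mem_inMod_iff.1 hh w
  refine ⟨comp 1 d a g, isGradedSub_iff.1 hM g hg a, homog_comp _ _ _ _, comp_mem_wtLT hg' _ _ _, ?_⟩
  rw [comp_comm, hgw, ← comp_comm, ha.comp_eq]

theorem isGradedSub_inMod (hM : IsGradedSub d M) : IsGradedSub d (inMod ω ε M) := by
  refine isGradedSub_iff.2 fun h hh a => mem_inMod_iff.2 fun w => ?_
  obtain ⟨g, hg, hg', hgw⟩ := mem_inMod_iff.1 hh w
  refine ⟨comp 1 d a g, isGradedSub_iff.1 hM g hg a, comp_mem_wtLT hg' _ _ _, ?_⟩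
  rw [comp_comm, hgw, ← comp_comm]

theorem isGradedSub_ker {φ : (Fin r → A K n) →ₗ[A K n] (Fin k → A K n)}
    (hφ : ∀ l, Homog 1 d (sh l) (φ (Pi.single l 1))) : IsGradedSub sh (LinearMap.ker φ) := by
  refine isGradedSub_iff.2 fun x hx a => ?_
  rw [LinearMap.mem_ker] at hx ⊢
  rw [map_comp hφ, hx, map_zero]

/-- The family of weight-`ε' l` components of `f l`. -/
noncomputable abbrev inFam (ω : Fin n → ℕ) (ε : Fin k → ℕ) (ε' : Fin r → ℕ)
    (f : Fin r → Fin k → A K n) : Fin r → Fin k → A K n :=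
  fun l => comp ω ε (ε' l) (f l)

theorem homog_genMap_inFam (l : Fin r) :
    Homog ω ε (ε' l) (genMap (inFam ω ε ε' f) (Pi.single l 1)) := by
  rw [genMap_single]
  exact homog_comp _ _ _ _

theorem genMap_inFam_comp (w : ℕ) (x : Fin r → A K n) :
    genMap (inFam ω ε ε' f) (comp ω ε' w x) = comp ω ε w (genMap (inFam ω ε ε' f) x) :=
  map_comp homog_genMap_inFam w x

theorem genMap_mem_wtLT (hf : ∀ l, f l ∈ wtLT K ω ε (ε' l + 1)) {w : ℕ} {x : Fin r → A K n}
    (hx : x ∈ wtLT K ω ε' w) : genMap f x ∈ wtLT K ω ε w := by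
  cases w with
  | zero => rw [eq_zero_of_mem_wtLT_zero hx, map_zero]; exact zero_mem _
  | succ w => exact map_mem_wtLT (fun l => by rw [genMap_single]; exact hf l) hx

theorem comp_genMap (hf : ∀ l, f l ∈ wtLT K ω ε (ε' l + 1)) {w : ℕ} {x : Fin r → A K n}
    (hx : x ∈ wtLT K ω ε' (w + 1)) :
    comp ω ε w (genMap f x) = genMap (inFam ω ε ε' f) (comp ω ε' w x) := by
  rw [genMap_inFam_comp, ← sub_eq_zero, ← map_sub]
  refine comp_eq_zero_of_mem_wtLT ?_
  rw [← LinearMap.sub_apply]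
  refine map_mem_wtLT (c := 0) (fun l => mem_wtLT_of_comp_eq_zero ?_ ?_) hx
  · rw [LinearMap.sub_apply, genMap_single, genMap_single]
    exact sub_mem (hf l) (homog_comp _ _ _ _).mem_wtLT
  · rw [LinearMap.sub_apply, genMap_single, genMap_single, add_zero, map_sub, comp_idem, sub_self]

/-- Standard representations: if the leading components of elements of `T` are hit by leading
components of elements of `T'`, then the elements of `T` lift to `T'` without raising weights. -/
theorem exists_lift_wtLT (hf : ∀ l, f l ∈ wtLT K ω ε (ε' l + 1))
    (T : Submodule K (Fin k → A K n)) (T' : Submodule K (Fin r → A K n))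
    (hT : ∀ x ∈ T', genMap f x ∈ T) (hT' : ∀ x ∈ T', ∀ w, comp ω ε' w x ∈ T')
    (h : ∀ w, ∀ g ∈ T, g ∈ wtLT K ω ε (w + 1) →
      ∃ y ∈ T', genMap (inFam ω ε ε' f) y = comp ω ε w g) :
    ∀ w, ∀ g ∈ T, g ∈ wtLT K ω ε w → ∃ x ∈ T', x ∈ wtLT K ω ε' w ∧ genMap f x = g := by
  intro w
  induction w with
  | zero =>
    intro g _ hg
    exact ⟨0, zero_mem _, zero_mem _, by rw [eq_zero_of_mem_wtLT_zero hg, map_zero]⟩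
  | succ w ih =>
    intro g hgT hg
    obtain ⟨y, hy, hyg⟩ := h w g hgT hg
    have hy' : comp ω ε' w y ∈ wtLT K ω ε' (w + 1) := (homog_comp _ _ _ _).mem_wtLT
    obtain ⟨x, hx, hxw, hxg⟩ := ih (g - genMap f (comp ω ε' w y))
      (sub_mem hgT (hT _ (hT' _ hy _)))
      (mem_wtLT_of_comp_eq_zero (sub_mem hg (genMap_mem_wtLT hf hy')) (by
        rw [map_sub, comp_genMap hf hy', genMap_inFam_comp, genMap_inFam_comp, hyg,
          comp_idem, comp_idem, sub_self]))
    refine ⟨x + comp ω ε' w y, add_mem hx (hT' _ hy _), add_mem (wtLT_mono w.le_succ hxw) hy', ?_⟩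
    rw [map_add, hxg, sub_add_cancel]

theorem exists_lift_wtLT_of_inMod_le (hf : ∀ l, f l ∈ wtLT K ω ε (ε' l + 1))
    (hfN : ∀ l, f l ∈ N) (h : inMod ω ε N ≤ LinearMap.range (genMap (inFam ω ε ε' f)))
    {w : ℕ} {g : Fin k → A K n} (hg : g ∈ N) (hgw : g ∈ wtLT K ω ε w) :
    ∃ x ∈ wtLT K ω ε' w, genMap f x = g := by
  obtain ⟨x, -, hx⟩ := exists_lift_wtLT hf (N.restrictScalars K) ⊤
    (fun x _ => genMap_mem hfN x) (fun _ _ _ => trivial)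
    (fun w g hg hgw => by
      obtain ⟨y, hy⟩ := h (comp_mem_inMod hg hgw)
      exact ⟨y, trivial, hy⟩) w g hg hgw
  exact ⟨x, hx⟩

theorem range_genMap_eq_of_inMod_le (hf : ∀ l, f l ∈ wtLT K ω ε (ε' l + 1))
    (hfN : ∀ l, f l ∈ N) (h : inMod ω ε N ≤ LinearMap.range (genMap (inFam ω ε ε' f))) :
    LinearMap.range (genMap f) = N := by
  refine le_antisymm ?_ fun g hg => ?_
  · rintro _ ⟨x, rfl⟩
    exact genMap_mem hfN x
  · obtain ⟨x, -, hx⟩ := exists_lift_wtLT_of_inMod_le hf hfN h hg (mem_wtLT_maxWt ω ε g)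
    exact ⟨x, hx⟩

theorem exists_lift_homog_wtLT (hf : ∀ l, f l ∈ wtLT K ω ε (ε' l + 1))
    (hfd : ∀ l, Homog 1 d (sh l) (f l)) (hfN : ∀ l, f l ∈ N) {a : ℕ}
    (h : ∀ w, ∀ g ∈ N, Homog 1 d a g → g ∈ wtLT K ω ε (w + 1) →
      comp ω ε w g ∈ LinearMap.range (genMap (inFam ω ε ε' f)))
    {w : ℕ} {g : Fin k → A K n} (hg : g ∈ N) (hga : Homog 1 d a g) (hgw : g ∈ wtLT K ω ε w) :
    ∃ x, Homog 1 sh a x ∧ x ∈ wtLT K ω ε' w ∧ genMap f x = g := by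
  have hφ : ∀ l, Homog 1 d (sh l) (genMap f (Pi.single l 1)) :=
    fun l => by rw [genMap_single]; exact hfd l
  have hφ' : ∀ l, Homog 1 d (sh l) (genMap (inFam ω ε ε' f) (Pi.single l 1)) :=
    fun l => by rw [genMap_single]; exact (hfd l).comp _ _ _
  obtain ⟨x, hx, hxg⟩ := exists_lift_wtLT hf (N.restrictScalars K ⊓ homogSub d a) (homogSub sh a)
    (fun x hx => ⟨genMap_mem hfN x, isHomog_iff.2 ((isHomog_iff.1 hx).map hφ)⟩)
    (fun x hx w => isHomog_iff.2 ((isHomog_iff.1 hx).comp _ _ _))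
    (fun w g hg hgw => by
      have hga := isHomog_iff.1 hg.2
      obtain ⟨y, hy⟩ := h w g hg.1 hga hgw
      refine ⟨comp 1 sh a y, isHomog_iff.2 (homog_comp _ _ _ _), ?_⟩
      rw [map_comp hφ', hy, (hga.comp _ _ _).comp_eq]) w g ⟨hg, isHomog_iff.2 hga⟩ hgw
  exact ⟨x, isHomog_iff.1 hx, hxg⟩

theorem mem_inMod_ker (hf : ∀ l, f l ∈ wtLT K ω ε (ε' l + 1)) {s : Fin r → A K n}
    (hs : genMap (inFam ω ε ε' f) s = 0)
    (h : ∀ w, genMap f (comp ω ε' w s) ∈ wtLT K ω ε w →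
      ∃ z ∈ wtLT K ω ε' w, genMap f z = genMap f (comp ω ε' w s)) :
    s ∈ inMod ω ε' (LinearMap.ker (genMap f)) := by
  refine mem_inMod_iff.2 fun w => ?_
  have hs' : comp ω ε' w s ∈ wtLT K ω ε' (w + 1) := (homog_comp _ _ _ _).mem_wtLT
  obtain ⟨z, hz, hzs⟩ := h w (mem_wtLT_of_comp_eq_zero (genMap_mem_wtLT hf hs')
    (by rw [comp_genMap hf hs', comp_idem, genMap_inFam_comp, hs, map_zero]))
  refine ⟨comp ω ε' w s - z, ?_, sub_mem hs' (wtLT_mono w.le_succ hz), ?_⟩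
  · rw [LinearMap.mem_ker, map_sub, hzs, sub_self]
  · rw [map_sub, comp_idem, comp_eq_zero_of_mem_wtLT hz, sub_zero]

theorem ker_genMap_inFam_eq_inMod (hf : ∀ l, f l ∈ wtLT K ω ε (ε' l + 1))
    (h : ∀ w x, genMap f x ∈ wtLT K ω ε w → ∃ z ∈ wtLT K ω ε' w, genMap f z = genMap f x) :
    LinearMap.ker (genMap (inFam ω ε ε' f)) = inMod ω ε' (LinearMap.ker (genMap f)) := by
  apply le_antisymm
  · exact fun s hs => mem_inMod_ker hf hs fun w => h w _
  · intro s hs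
    refine mem_of_comp_mem ω ε' fun w => ?_
    obtain ⟨x, hx, hxw, hxs⟩ := mem_inMod_iff.1 hs w
    rw [LinearMap.mem_ker, ← hxs, ← comp_genMap hf hxw, LinearMap.mem_ker.1 hx, map_zero]

/-- If every syzygy of the leading components lifts to a syzygy, then the leading components
generate the initial module. -/
theorem inMod_range_le_of_ker_le (hf : ∀ l, f l ∈ wtLT K ω ε (ε' l + 1))
    (hker : LinearMap.ker (genMap (inFam ω ε ε' f)) ≤ inMod ω ε' (LinearMap.ker (genMap f))) :
    inMod ω ε (LinearMap.range (genMap f)) ≤ LinearMap.range (genMap (inFam ω ε ε' f)) := by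
  have key : ∀ v w x, x ∈ wtLT K ω ε' v → genMap f x ∈ wtLT K ω ε w →
      ∃ z ∈ wtLT K ω ε' w, genMap f z = genMap f x := by
    intro v
    induction v with
    | zero => exact fun w x hx _ => ⟨x, wtLT_mono w.zero_le hx, rfl⟩
    | succ v ih =>
      intro w x hx hxw
      by_cases hvw : v + 1 ≤ w
      · exact ⟨x, wtLT_mono hvw hx, rfl⟩
      have h0 : comp ω ε' v x ∈ LinearMap.ker (genMap (inFam ω ε ε' f)) := by
        rw [LinearMap.mem_ker, ← comp_genMap hf hx]
        exact comp_eq_zero_of_mem_wtLT (wtLT_mono (by omega) hxw)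
      obtain ⟨z, hz, hzv, hzx⟩ := mem_inMod_iff.1 (hker h0) v
      have hxz : genMap f (x - z) = genMap f x := by
        rw [map_sub, LinearMap.mem_ker.1 hz, sub_zero]
      rw [← hxz] at hxw ⊢
      exact ih w _ (mem_wtLT_of_comp_eq_zero (sub_mem hx hzv)
        (by rw [map_sub, hzx, comp_idem, sub_self])) hxw
  intro h hh
  refine mem_of_comp_mem ω ε fun w => ?_
  obtain ⟨_, ⟨x, rfl⟩, hgw, hg⟩ := mem_inMod_iff.1 hh w
  obtain ⟨z, hz, hzx⟩ := key _ _ x (mem_wtLT_maxWt ω ε' x) hgw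
  rw [← hg, ← hzx, comp_genMap hf hz]
  exact ⟨_, rfl⟩

end InitialModules

end CregPaper

namespace CregPaper

section Generators

variable {K : Type*} [Field K] {n k r : ℕ} {d : Fin k → ℕ} {sh : Fin r → ℕ}
  {f : Fin r → Fin k → A K n} {M N : Submodule (A K n) (Fin k → A K n)}

theorem range_genMap (f : Fin r → Fin k → A K n) :
    LinearMap.range (genMap f) = Submodule.span (A K n) (Set.range f) :=
  Fintype.range_linearCombination (A K n) f

/-- Homogeneous generators none of which can be dropped have all relations in `m A^r`. -/
theorem mem_mIdeal_of_minimal (hf : ∀ l, Homog 1 d (sh l) (f l))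
    (hmin : ∀ r' (g : Fin r' → Fin k → A K n), Set.range g ⊆ Set.range f →
      LinearMap.range (genMap g) = LinearMap.range (genMap f) → r ≤ r')
    {x : Fin r → A K n} (hx : genMap f x = 0) (l : Fin r) : x l ∈ mIdeal K n := by
  rw [mem_mIdeal]
  by_contra hc
  obtain ⟨r, rfl⟩ : ∃ s, r = s + 1 := ⟨r - 1, by have := l.pos; omega⟩
  refine absurd (hmin r (f ∘ l.succAbove) (Set.range_comp_subset_range _ _) ?_) (by omega)
  set y := comp 1 sh (sh l) x with hy
  have hy0 : genMap f y = 0 := by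
    rw [hy, map_comp (ε := d) (fun l => by rw [genMap_single]; exact hf l), hx, map_zero]
  have hyl : y l = MvPolynomial.C ((x l).coeff 0) := by
    ext u
    rw [hy, coeff_comp, MvPolynomial.coeff_C]
    by_cases hu : u = 0
    · simp [hu, wdeg_zero]
    · rw [if_neg, if_neg (Ne.symm hu)]
      exact fun h => hu (eq_zero_of_wdeg_one (by omega))
  have hfl : f l ∈ LinearMap.range (genMap (f ∘ l.succAbove)) := by
    refine ⟨fun i => -(MvPolynomial.C ((x l).coeff 0)⁻¹ * y (l.succAbove i)), ?_⟩
    rw [genMap, Fintype.linearCombination_apply, Fin.sum_univ_succAbove _ l, hyl] at hy0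
    rw [genMap, Fintype.linearCombination_apply]
    simp only [neg_smul, mul_smul, Finset.sum_neg_distrib, ← Finset.smul_sum, Function.comp_apply]
    rw [← smul_neg, ← eq_neg_of_add_eq_zero_left hy0, ← mul_smul, ← map_mul,
      inv_mul_cancel₀ hc, map_one, one_smul]
  apply le_antisymm
  · rw [range_genMap, range_genMap]
    exact Submodule.span_mono (Set.range_comp_subset_range _ _)
  · rw [range_genMap f, Submodule.span_le]
    rintro _ ⟨i, rfl⟩
    rcases Fin.eq_self_or_eq_succAbove l i with rfl | ⟨j, rfl⟩
    · exact hfl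
    · exact ⟨Pi.single j 1, genMap_single _ _⟩

/-- Among the generating families contained in a set there is one of minimal length. -/
theorem exists_minimal_family (S : Set (Fin k → A K n)) :
    ∃ (r : ℕ) (f : Fin r → Fin k → A K n), (∀ l, f l ∈ S) ∧
      LinearMap.range (genMap f) = Submodule.span (A K n) S ∧
      ∀ r' (g : Fin r' → Fin k → A K n), (∀ l, g l ∈ S) →
        LinearMap.range (genMap g) = Submodule.span (A K n) S → r ≤ r' := by
  classical
  have hex : ∃ (r : ℕ) (f : Fin r → Fin k → A K n), (∀ l, f l ∈ S) ∧
      LinearMap.range (genMap f) = Submodule.span (A K n) S := by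
    obtain ⟨t, hts, ht⟩ := (Submodule.fg_span_iff_fg_span_finset_subset S).1
      (IsNoetherian.noetherian (Submodule.span (A K n) S))
    refine ⟨t.card, fun l => (t.equivFin.symm l : Fin k → A K n),
      fun l => hts (t.equivFin.symm l).2, ?_⟩
    rw [range_genMap, ht]
    congr 1
    ext g
    constructor
    · rintro ⟨l, rfl⟩
      exact (t.equivFin.symm l).2
    · intro hg
      exact ⟨t.equivFin ⟨g, hg⟩, by simp⟩
  obtain ⟨f, hf⟩ := Nat.find_spec hex
  exact ⟨Nat.find hex, f, hf.1, hf.2, fun r' g hg hg' => Nat.find_min' hex ⟨g, hg, hg'⟩⟩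

theorem span_homog (hN : IsGradedSub d N) :
    Submodule.span (A K n) {g | g ∈ N ∧ ∃ a, Homog 1 d a g} = N := by
  refine le_antisymm (Submodule.span_le.2 fun g hg => hg.1) fun g hg => ?_
  exact mem_of_comp_mem 1 d fun a =>
    Submodule.subset_span ⟨isGradedSub_iff.1 hN g hg a, a, homog_comp _ _ _ _⟩

theorem exists_minimal_homog_generators (hN : IsGradedSub d N) :
    ∃ (r : ℕ) (sh : Fin r → ℕ) (f : Fin r → Fin k → A K n), (∀ l, Homog 1 d (sh l) (f l)) ∧
      LinearMap.range (genMap f) = N ∧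
      ∀ x, genMap f x = 0 → ∀ l, x l ∈ mIdeal K n := by
  obtain ⟨r, f, hf, hspan, hmin⟩ := exists_minimal_family {g | g ∈ N ∧ ∃ a, Homog 1 d a g}
  choose hfN sh hsh using hf
  refine ⟨r, sh, f, hsh, hspan.trans (span_homog hN), fun x hx l => ?_⟩
  refine mem_mIdeal_of_minimal hsh (fun r' g hg hg' => hmin r' g (fun l => ?_) (hg'.trans hspan))
    hx l
  obtain ⟨i, hi⟩ := hg ⟨l, rfl⟩
  rw [← hi]
  exact ⟨hfN i, sh i, hsh i⟩

/-- Build a graded free resolution by iterating a syzygy step preserving a condition `C`. -/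
theorem exists_resolution
    (C : ℕ → (k : ℕ) → (Fin k → ℕ) → Submodule (A K n) (Fin k → A K n) → Prop)
    (step : ∀ i k d N, C i k d N → ∃ (r : ℕ) (sh : Fin r → ℕ)
      (φ : (Fin r → A K n) →ₗ[A K n] (Fin k → A K n)), LinearMap.range φ = N ∧
        (∀ l, IsHomog d (sh l) (φ (Pi.single l 1))) ∧ C (i + 1) r sh (LinearMap.ker φ))
    (φ : (Fin r → A K n) →ₗ[A K n] (Fin k → A K n)) (hφN : LinearMap.range φ = N)
    (hφ : ∀ l, IsHomog d (sh l) (φ (Pi.single l 1))) (hC : C 0 r sh (LinearMap.ker φ)) :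
    ∃ res : GFRes d N, res.rk 0 = r ∧
      ∀ i, C i (res.rk i) (res.sh i) (LinearMap.range (res.diff i)) := by
  choose R SH Φ hΦ using step
  let T (i : ℕ) := {s : (k : ℕ) × (Fin k → ℕ) × Submodule (A K n) (Fin k → A K n) //
    C i s.1 s.2.1 s.2.2}
  let seq : (i : ℕ) → T i := fun i => Nat.rec (motive := T) ⟨⟨r, sh, LinearMap.ker φ⟩, hC⟩
    (fun i s => ⟨⟨R i _ _ _ s.2, SH i _ _ _ s.2, LinearMap.ker (Φ i _ _ _ s.2)⟩,
      (hΦ i _ _ _ s.2).2.2⟩) i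
  refine ⟨{
    rk := fun i => (seq i).1.1
    sh := fun i => (seq i).1.2.1
    aug := φ
    diff := fun i => Φ i _ _ _ (seq i).2
    aug_range := hφN
    aug_hom := hφ
    diff_hom := fun i => (hΦ i _ _ _ (seq i).2).2.1
    ex0 := (hΦ 0 _ _ _ (seq 0).2).1
    exs := fun i => (hΦ (i + 1) _ _ _ (seq (i + 1)).2).1 }, rfl, fun i => ?_⟩
  have := (seq i).2
  rwa [← (hΦ i _ _ _ (seq i).2).1] at this

theorem exists_minimal_resolution (hf : ∀ l, Homog 1 d (sh l) (f l))
    (hfN : LinearMap.range (genMap f) = N)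
    (hker : ∀ x, genMap f x = 0 → ∀ l, x l ∈ mIdeal K n) :
    ∃ res : GFRes d N, res.Minimal ∧ res.rk 0 = r := by
  obtain ⟨res, hr, hC⟩ := exists_resolution
    (fun _ _ d N => IsGradedSub d N ∧ ∀ x ∈ N, ∀ l, x l ∈ mIdeal K n)
    (by
      rintro i k d N ⟨hN, -⟩
      obtain ⟨r, sh, f, hf, hfN, hker⟩ := exists_minimal_homog_generators hN
      have hf' : ∀ l, Homog 1 d (sh l) (genMap f (Pi.single l 1)) :=
        fun l => by rw [genMap_single]; exact hf l
      exact ⟨r, sh, genMap f, hfN, fun l => isHomog_iff.2 (hf' l), isGradedSub_ker hf', hker⟩)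
    (genMap f) hfN (fun l => by rw [genMap_single]; exact isHomog_iff.2 (hf l))
    ⟨isGradedSub_ker (d := d) (fun l => by rw [genMap_single]; exact hf l), hker⟩
  exact ⟨res, fun i x l => (hC i).2 _ ⟨x, rfl⟩ l, hr⟩

end Generators

section LinearResolutions

variable {K : Type*} [Field K] {n k r : ℕ} {ω : Fin n → ℕ} {d ε : Fin k → ℕ}
  {f : Fin r → Fin k → A K n} {M N : Submodule (A K n) (Fin k → A K n)} {c : ℕ}

theorem compSub_le (d : Fin k → ℕ) (M : Submodule (A K n) (Fin k → A K n)) (a : ℕ) :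
    compSub d M a ≤ M :=
  Submodule.span_le.2 fun _ h => h.1

theorem mem_compSub {a : ℕ} {g : Fin k → A K n} (hg : g ∈ M) (ha : Homog 1 d a g) :
    g ∈ compSub d M a :=
  Submodule.subset_span ⟨hg, isHomog_iff.2 ha⟩

/-- `N` has no nonzero homogeneous elements of degree less than `c`. -/
def NoneBelow (d : Fin k → ℕ) (N : Submodule (A K n) (Fin k → A K n)) (c : ℕ) : Prop :=
  ∀ b < c, ∀ g ∈ N, Homog 1 d b g → g = 0

theorem eq_zero_of_homog_of_mem_mIdeal {x : Fin r → A K n} {b : ℕ} (hb : b ≤ c)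
    (hx : Homog 1 (fun _ => c) b x) (hm : ∀ l, x l ∈ mIdeal K n) : x = 0 := by
  ext l u
  by_contra hu
  have h1 : wdeg 1 u + c = b := hx l u hu
  obtain rfl : u = 0 := eq_zero_of_wdeg_one (by omega)
  exact hu (by simpa using mem_mIdeal.1 (hm l))

theorem noneBelow_of_mem_mIdeal {N : Submodule (A K n) (Fin r → A K n)}
    (h : ∀ x ∈ N, ∀ l, x l ∈ mIdeal K n) : NoneBelow (fun _ => c) N (c + 1) :=
  fun _ hb g hg hgb => eq_zero_of_homog_of_mem_mIdeal (by omega) hgb (h g hg)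

theorem noneBelow_compSub (d : Fin k → ℕ) (M : Submodule (A K n) (Fin k → A K n)) (a : ℕ) :
    NoneBelow d (compSub d M a) a := by
  have key : ∀ g ∈ compSub d M a, ∀ b < a, comp 1 d b g = 0 := by
    intro g hg
    induction hg using Submodule.span_induction with
    | mem g hg => exact fun b hb => (isHomog_iff.1 hg.2).comp_eq_zero hb.ne
    | zero => exact fun b _ => map_zero _
    | add x y _ _ hx hy => exact fun b hb => by rw [map_add, hx b hb, hy b hb, add_zero]
    | smul p x _ hx =>
      induction p using MvPolynomial.induction_on' with
      | monomial u s =>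
        intro b hb
        by_cases hbu : b < wdeg 1 u
        · exact comp_monomial_smul_of_lt u s hbu
        · obtain ⟨v, rfl⟩ := exists_add_of_le (not_lt.1 hbu)
          rw [comp_monomial_smul, hx v (by omega), smul_zero]
      | add p q hp hq => exact fun b hb => by rw [add_smul, map_add, hp b hb, hq b hb, add_zero]
  intro b hb g hg hgb
  rw [← hgb.comp_eq, key g hg b hb]

theorem noneBelow_inMod (hN : IsGradedSub d N) (h : NoneBelow d N c) :
    NoneBelow d (inMod ω ε N) c := by
  intro b hb g hg hgb
  refine (Submodule.mem_bot (A K n)).1 (mem_of_comp_mem ω ε fun w => ?_)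
  obtain ⟨g', hg', hgb', -, hgw⟩ := exists_homog_of_mem_inMod hN hg hgb w
  rw [← hgw, h b hb g' hg' hgb', map_zero]
  exact zero_mem _

theorem noneBelow_of_inMod (h : NoneBelow d (inMod ω ε N) c) : NoneBelow d N c := by
  intro b hb g hg hgb
  exact eq_zero_of_forall_comp_eq_zero ω ε fun w hw =>
    h b hb _ (comp_mem_inMod hg hw) (hgb.comp _ _ _)

theorem mem_mIdeal_of_noneBelow {N : Submodule (A K n) (Fin r → A K n)}
    (hN : IsGradedSub (fun _ => c) N) (h : NoneBelow (fun _ => c) N (c + 1))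
    {x : Fin r → A K n} (hx : x ∈ N) (l : Fin r) : x l ∈ mIdeal K n := by
  have h0 := h c c.lt_succ_self _ (isGradedSub_iff.1 hN x hx c) (homog_comp _ _ _ _)
  have := coeff_comp 1 (fun _ => c) c x l 0
  rw [h0, if_pos (by simp [wdeg_zero])] at this
  exact mem_mIdeal.2 (by simpa using this.symm)

theorem isGradedSub_compSub (d : Fin k → ℕ) (M : Submodule (A K n) (Fin k → A K n)) (a : ℕ) :
    IsGradedSub d (compSub d M a) := by
  refine isGradedSub_iff.2 fun g hg => ?_
  induction hg using Submodule.span_induction with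
  | mem g hg =>
    intro b
    have hga := isHomog_iff.1 hg.2
    by_cases hb : b = a
    · subst hb
      rw [hga.comp_eq]
      exact mem_compSub hg.1 hga
    · rw [hga.comp_eq_zero hb]
      exact zero_mem _
  | zero => exact fun b => by rw [map_zero]; exact zero_mem _
  | add x y _ _ hx hy => exact fun b => by rw [map_add]; exact add_mem (hx b) (hy b)
  | smul p x _ hx =>
    induction p using MvPolynomial.induction_on' with
    | monomial u s =>
      intro b
      by_cases hbu : b < wdeg 1 u
      · rw [comp_monomial_smul_of_lt u s hbu]
        exact zero_mem _
      · obtain ⟨v, rfl⟩ := exists_add_of_le (not_lt.1 hbu)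
        rw [comp_monomial_smul]
        exact Submodule.smul_mem _ _ (hx v)
    | add p q hp hq => exact fun b => by rw [add_smul, map_add]; exact add_mem (hp b) (hq b)

theorem RegLE.compSub_eq (h : RegLE d N c) (hN : NoneBelow d N c) : compSub d N c = N := by
  refine le_antisymm (compSub_le _ _ _) ?_
  obtain ⟨res, -, hsh⟩ := h
  conv_lhs => rw [← res.aug_range]
  rintro _ ⟨x, rfl⟩
  rw [eq_sum_monomial_smul x]
  simp only [map_sum, map_smul]
  refine sum_mem fun l _ => sum_mem fun u _ => Submodule.smul_mem _ _ ?_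
  have hmem : res.aug (Pi.single l 1) ∈ N := res.aug_range.le ⟨_, rfl⟩
  have hl := isHomog_iff.1 (res.aug_hom l)
  rcases (show res.sh 0 l ≤ c by simpa using hsh 0 l).lt_or_eq with hlt | heq
  · rw [hN _ hlt _ hmem hl]
    exact zero_mem _
  · exact mem_compSub hmem (heq ▸ hl)

/-- The syzygies of a minimal generating family in degree `c` of a module with a `c`-linear
resolution have a `(c + 1)`-linear resolution. -/
theorem RegLE.ker (h : RegLE d N c) (hN : NoneBelow d N c) (hf : ∀ l, Homog 1 d c (f l))
    (hfN : LinearMap.range (genMap f) = N)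
    (hker : ∀ x, genMap f x = 0 → ∀ l, x l ∈ mIdeal K n) :
    RegLE (fun _ => c) (LinearMap.ker (genMap f)) (c + 1) := by
  obtain ⟨res, hmin, hsh⟩ := h
  have hf' : ∀ l, Homog 1 d ((fun _ => c) l) (genMap f (Pi.single l 1)) :=
    fun l => by rw [genMap_single]; exact hf l
  have haug : ∀ x, res.aug x = 0 → ∀ l, x l ∈ mIdeal K n := by
    intro x hx l
    obtain ⟨y, rfl⟩ : x ∈ LinearMap.range (res.diff 0) := res.ex0 ▸ hx
    exact hmin 0 y l
  have hsh0 : res.sh 0 = fun _ => c := by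
    funext l
    refine le_antisymm (by simpa using hsh 0 l) (not_lt.1 fun hlt => ?_)
    have h0 := hN _ hlt (res.aug (Pi.single l 1)) (res.aug_range.le ⟨_, rfl⟩)
      (isHomog_iff.1 (res.aug_hom l))
    have := mem_mIdeal.1 (haug _ h0 l)
    simp at this
  have haug' : ∀ l, Homog 1 d ((fun _ => c) l) (res.aug (Pi.single l 1)) :=
    fun l => hsh0 ▸ isHomog_iff.1 (res.aug_hom l)
  have hα : ∀ l, ∃ x, Homog 1 (fun _ => c) c x ∧ res.aug x = f l := by
    intro l
    obtain ⟨x, hx⟩ : f l ∈ LinearMap.range res.aug := by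
      rw [res.aug_range, ← hfN]
      exact ⟨_, genMap_single f l⟩
    exact ⟨comp 1 (fun _ => c) c x, homog_comp _ _ _ _, by
      rw [map_comp haug', hx, (hf l).comp_eq]⟩
  have hβ : ∀ l, ∃ x, Homog 1 (fun _ => c) c x ∧ genMap f x = res.aug (Pi.single l 1) := by
    intro l
    obtain ⟨x, hx⟩ : res.aug (Pi.single l 1) ∈ LinearMap.range (genMap f) := by
      rw [hfN]
      exact res.aug_range.le ⟨_, rfl⟩
    exact ⟨comp 1 (fun _ => c) c x, homog_comp _ _ _ _, by
      rw [map_comp hf', hx, (haug' l).comp_eq]⟩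
  choose a ha haf using hα
  choose b hb hbf using hβ
  have hbh : ∀ l, Homog 1 (fun _ => c) ((fun _ => c) l) (genMap b (Pi.single l 1)) :=
    fun l => by rw [genMap_single]; exact hb l
  have hah : ∀ l, Homog 1 (fun _ => c) ((fun _ => c) l) (genMap a (Pi.single l 1)) :=
    fun l => by rw [genMap_single]; exact ha l
  have hfb : ∀ x, genMap f (genMap b x) = res.aug x := by
    intro x
    rw [← LinearMap.comp_apply]
    congr 1
    refine LinearMap.pi_ext' fun l => LinearMap.ext_ring ?_
    simp only [LinearMap.comp_apply, LinearMap.coe_single, genMap_single, hbf]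
  have hfa : ∀ x, res.aug (genMap a x) = genMap f x := by
    intro x
    rw [← LinearMap.comp_apply]
    congr 1
    refine LinearMap.pi_ext' fun l => LinearMap.ext_ring ?_
    simp only [LinearMap.comp_apply, LinearMap.coe_single, genMap_single, haf]
  have hba : ∀ x, genMap b (genMap a x) = x := by
    intro x
    rw [← LinearMap.comp_apply]
    conv_rhs => rw [← LinearMap.id_apply (R := A K n) x]
    congr 1
    refine LinearMap.pi_ext' fun l => LinearMap.ext_ring ?_
    simp only [LinearMap.comp_apply, LinearMap.coe_single, LinearMap.id_apply]
    rw [← sub_eq_zero]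
    have hz : Homog 1 (fun _ => c) c
        (genMap b (genMap a (Pi.single l 1)) - Pi.single l 1 : Fin r → A K n) :=
      isHomog_iff.1 ((homogSub (fun _ => c) c).sub_mem
        (isHomog_iff.2 ((hah l).map hbh)) (isHomog_iff.2 (homog_single (fun _ => c) 1 l)))
    exact eq_zero_of_homog_of_mem_mIdeal le_rfl hz
      (hker _ (by rw [map_sub, hfb, hfa, sub_self]))
  have hab : ∀ x, genMap a (genMap b x) = x := by
    intro x
    rw [← LinearMap.comp_apply]
    conv_rhs => rw [← LinearMap.id_apply (R := A K n) x]
    congr 1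
    refine LinearMap.pi_ext' fun l => LinearMap.ext_ring ?_
    simp only [LinearMap.comp_apply, LinearMap.coe_single, LinearMap.id_apply]
    rw [← sub_eq_zero]
    have hz : Homog 1 (fun _ => c) c
        (genMap a (genMap b (Pi.single l 1)) - Pi.single l 1 : Fin (res.rk 0) → A K n) :=
      isHomog_iff.1 ((homogSub (fun _ => c) c).sub_mem
        (isHomog_iff.2 ((hbh l).map hah)) (isHomog_iff.2 (homog_single (fun _ => c) 1 l)))
    exact eq_zero_of_homog_of_mem_mIdeal le_rfl hz
      (haug _ (by rw [map_sub, hfa, hfb, sub_self]))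
  have hbinj : LinearMap.ker (genMap b) = ⊥ :=
    LinearMap.ker_eq_bot.2 (Function.LeftInverse.injective hab)
  refine ⟨{
    rk := fun i => res.rk (i + 1)
    sh := fun i => res.sh (i + 1)
    aug := genMap b ∘ₗ res.diff 0
    diff := fun i => res.diff (i + 1)
    aug_range := ?_
    aug_hom := fun l => isHomog_iff.2 (Homog.map hbh (hsh0 ▸ isHomog_iff.1 (res.diff_hom 0 l)))
    diff_hom := fun i => res.diff_hom (i + 1)
    ex0 := ?_
    exs := fun i => res.exs (i + 1) }, fun i => hmin (i + 1), fun i l => ?_⟩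
  · rw [LinearMap.range_comp, res.ex0]
    ext x
    constructor
    · rintro ⟨y, hy, rfl⟩
      rw [LinearMap.mem_ker, hfb]
      exact hy
    · intro hx
      refine ⟨genMap a x, ?_, hba x⟩
      change res.aug _ = 0
      rw [hfa]
      exact hx
  · rw [LinearMap.ker_comp_of_ker_eq_bot _ hbinj]
    exact res.exs 0
  · have := hsh (i + 1) l
    dsimp only
    omega

/-- Elements of `N` of degree `c` whose leading components minimally generate the submodule
generated by the degree-`c` part of the initial module. -/
theorem exists_leading_generators (hN : IsGradedSub d N) (ω : Fin n → ℕ) (ε : Fin k → ℕ) (c : ℕ) :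
    ∃ (r : ℕ) (ε' : Fin r → ℕ) (f : Fin r → Fin k → A K n), (∀ l, f l ∈ N) ∧
      (∀ l, Homog 1 d c (f l)) ∧ (∀ l, f l ∈ wtLT K ω ε (ε' l + 1)) ∧
      LinearMap.range (genMap (inFam ω ε ε' f)) = compSub d (inMod ω ε N) c ∧
      ∀ x, genMap (inFam ω ε ε' f) x = 0 → ∀ l, x l ∈ mIdeal K n := by
  set S : Set (Fin k → A K n) :=
    {h | ∃ g ∈ N, Homog 1 d c g ∧ ∃ w, g ∈ wtLT K ω ε (w + 1) ∧ h = comp ω ε w g} with hS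
  have hspan : Submodule.span (A K n) S = compSub d (inMod ω ε N) c := by
    apply le_antisymm
    · rw [Submodule.span_le]
      rintro _ ⟨g, hg, hgc, w, hgw, rfl⟩
      exact mem_compSub (comp_mem_inMod hg hgw) (hgc.comp _ _ _)
    · refine Submodule.span_le.2 fun h hh => mem_of_comp_mem ω ε fun w => ?_
      obtain ⟨g, hg, hgc, hgw, hgh⟩ :=
        exists_homog_of_mem_inMod hN hh.1 (isHomog_iff.1 hh.2) w
      exact Submodule.subset_span ⟨g, hg, hgc, w, hgw, hgh.symm⟩
  obtain ⟨r, h, hhS, hh, hmin⟩ := exists_minimal_family S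
  choose f hfN hfc ε' hfw hfh using id hhS
  obtain rfl : h = inFam ω ε ε' f := funext hfh
  refine ⟨r, ε', f, hfN, hfc, hfw, hh.trans hspan, fun x hx l => ?_⟩
  refine mem_mIdeal_of_minimal (d := d) (sh := fun _ => c) (fun l => (hfc l).comp _ _ _)
    (fun r' g hg hg' => hmin r' g (fun l => ?_) (hg'.trans hh)) hx l
  obtain ⟨i, hi⟩ := hg ⟨l, rfl⟩
  rw [← hi]
  exact hhS i

/-- A linear resolution of the initial module yields one step of a linear resolution. -/
theorem exists_linear_step (hN : IsGradedSub d N) (hlow : NoneBelow d N c)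
    (hreg : RegLE d (inMod ω ε N) c) :
    ∃ (r : ℕ) (f : Fin r → Fin k → A K n), LinearMap.range (genMap f) = N ∧
      (∀ l, Homog 1 d c (f l)) ∧ (∀ x, genMap f x = 0 → ∀ l, x l ∈ mIdeal K n) ∧
      ∃ ε' : Fin r → ℕ, RegLE (fun _ => c) (inMod ω ε' (LinearMap.ker (genMap f))) (c + 1) := by
  obtain ⟨r, ε', f, hfN, hfc, hfw, hrange, hker⟩ := exists_leading_generators hN ω ε c
  have hlow' := noneBelow_inMod (ω := ω) (ε := ε) hN hlow
  rw [hreg.compSub_eq hlow'] at hrange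
  have hfr := range_genMap_eq_of_inMod_le hfw hfN hrange.ge
  have hkin := ker_genMap_inFam_eq_inMod hfw fun w x hx =>
    exists_lift_wtLT_of_inMod_le hfw hfN hrange.ge (genMap_mem hfN x) hx
  have hreg' := hreg.ker hlow' (fun l => (hfc l).comp _ _ _) hrange hker
  rw [hkin] at hreg'
  have hf' : ∀ l, Homog 1 d ((fun _ => c) l) (genMap f (Pi.single l 1)) :=
    fun l => by rw [genMap_single]; exact hfc l
  have hlow₁ : NoneBelow (fun _ => c) (inMod ω ε' (LinearMap.ker (genMap f))) (c + 1) :=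
    hkin ▸ noneBelow_of_mem_mIdeal (N := LinearMap.ker (genMap (inFam ω ε ε' f))) hker
  exact ⟨r, f, hfr, hfc,
    fun x hx => mem_mIdeal_of_noneBelow (isGradedSub_ker hf') (noneBelow_of_inMod hlow₁) hx,
    ε', hreg'⟩

end LinearResolutions

end CregPaper

namespace CregPaper

section ComponentwiseLinear

variable {K : Type*} [Field K] {n k r : ℕ} {ω : Fin n → ℕ} {d ε : Fin k → ℕ}
  {ε' sh : Fin r → ℕ} {f : Fin r → Fin k → A K n} {M N : Submodule (A K n) (Fin k → A K n)}

/-- If the initial module has a `c`-linear resolution, then so does the module. -/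
theorem RegLE.of_inMod {c : ℕ} (hN : IsGradedSub d N) (hlow : NoneBelow d N c)
    (hreg : RegLE d (inMod ω ε N) c) : RegLE d N c := by
  let C : ℕ → (k : ℕ) → (Fin k → ℕ) → Submodule (A K n) (Fin k → A K n) → Prop :=
    fun i k d N => d = (fun _ => c + i) ∧ IsGradedSub d N ∧ (∀ x ∈ N, ∀ l, x l ∈ mIdeal K n) ∧
      ∃ ε : Fin k → ℕ, RegLE d (inMod ω ε N) (c + i + 1)
  have step : ∀ {k : ℕ} {d ε : Fin k → ℕ} {N : Submodule (A K n) (Fin k → A K n)} (i : ℕ),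
      IsGradedSub d N → NoneBelow d N (c + i) → RegLE d (inMod ω ε N) (c + i) →
      ∃ (r : ℕ) (sh : Fin r → ℕ) (φ : (Fin r → A K n) →ₗ[A K n] (Fin k → A K n)),
        LinearMap.range φ = N ∧ (∀ l, IsHomog d (sh l) (φ (Pi.single l 1))) ∧
        C i r sh (LinearMap.ker φ) := by
    intro k d ε N i hN hlow hreg
    obtain ⟨r, f, hfN, hf, hker, hε⟩ := exists_linear_step hN hlow hreg
    have hf' : ∀ l, Homog 1 d ((fun _ => c + i) l) (genMap f (Pi.single l 1)) :=
      fun l => by rw [genMap_single]; exact hf l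
    exact ⟨r, _, genMap f, hfN, fun l => isHomog_iff.2 (hf' l), rfl, isGradedSub_ker hf',
      hker, hε⟩
  obtain ⟨r, sh, φ, hφN, hφ, hC⟩ := step 0 hN hlow hreg
  obtain ⟨res, -, hres⟩ := exists_resolution C
    (by
      rintro i k d N ⟨rfl, hN, hm, ε, hreg⟩
      exact step (i + 1) hN (noneBelow_of_mem_mIdeal hm) hreg) φ hφN hφ hC
  refine ⟨res, fun i x l => (hres i).2.2.1 _ ⟨x, rfl⟩ l, fun i l => ?_⟩
  have : res.sh i l = c + i := congrFun (hres i).1 l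
  omega

theorem smul_mem_compSub {p : A K n} {q : Fin k → A K n} {a b : ℕ} (hq : q ∈ N)
    (hqb : Homog 1 d b q) (hp : p ∈ mIdeal K n)
    (hpb : ∀ u, p.coeff u ≠ 0 → wdeg 1 u + b = a + 1) : p • q ∈ compSub d N a := by
  rw [p.as_sum, Finset.sum_smul]
  refine sum_mem fun u hu => ?_
  rw [MvPolynomial.mem_support_iff] at hu
  obtain ⟨i, hi⟩ : ∃ i, u i ≠ 0 := by
    by_contra! h
    exact hu (by rw [show u = 0 from Finsupp.ext h]; exact mem_mIdeal.1 hp)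
  obtain ⟨v, rfl⟩ : ∃ v, u = Finsupp.single i 1 + v :=
    exists_add_of_le (Finsupp.single_le_iff.2 (Nat.one_le_iff_ne_zero.2 hi))
  have hv := hpb _ hu
  rw [wdeg_add, show wdeg 1 (Finsupp.single i 1) = 1 by simp [wdeg]] at hv
  rw [← one_mul (MvPolynomial.coeff _ p), ← MvPolynomial.monomial_mul, mul_smul]
  refine Submodule.smul_mem _ _ (mem_compSub (N.smul_mem _ hq) ?_)
  rw [show a = wdeg 1 v + b by omega]
  exact hqb.monomial_smul v _

/-- Let the leading components of `f` generate the initial module of `M`, where `f` minimally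
generates `M`. Then leading components in degree `a + 1` of the module generated by `M_a` lie in
the module generated by the degree-`a` part of the initial module. -/
theorem comp_mem_compSub_inMod
    (hf : ∀ l, f l ∈ wtLT K ω ε (ε' l + 1)) (hfd : ∀ l, Homog 1 d (sh l) (f l))
    (hfM : ∀ l, f l ∈ M) (hin : LinearMap.range (genMap (inFam ω ε ε' f)) = inMod ω ε M)
    (hker : ∀ x, genMap f x = 0 → ∀ l, x l ∈ mIdeal K n)
    {m a w : ℕ} {b : Fin m → Fin k → A K n} (hb : ∀ l, Homog 1 d a (b l)) (hbM : ∀ l, b l ∈ M)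
    {g : Fin k → A K n} (hg : g ∈ LinearMap.range (genMap b)) (hga : Homog 1 d (a + 1) g)
    (hgw : g ∈ wtLT K ω ε (w + 1)) : comp ω ε w g ∈ compSub d (inMod ω ε M) a := by
  have hgM : g ∈ M := by
    obtain ⟨p, rfl⟩ := hg
    exact genMap_mem hbM p
  obtain ⟨x, hxa, hxw, hxg⟩ := exists_lift_homog_wtLT hf hfd hfM
    (fun w g hg _ hgw => hin ▸ comp_mem_inMod hg hgw) hgM hga hgw
  obtain ⟨y, hy, hyg⟩ : ∃ y : Fin r → A K n, (∀ l, y l ∈ mIdeal K n) ∧ genMap f y = g := by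
    obtain ⟨p, hp⟩ := hg
    have hfr := range_genMap_eq_of_inMod_le hf hfM hin.ge
    have ht : ∀ i, ∃ t, genMap f t = b i := fun i => hfr.ge (hbM i)
    choose t ht using ht
    refine ⟨∑ i, comp 1 (fun _ => a) (a + 1) p i • t i, fun l => ?_, ?_⟩
    · rw [Finset.sum_apply]
      refine sum_mem fun i _ => Ideal.mul_mem_right _ _ (mem_mIdeal.2 ?_)
      rw [coeff_comp, if_neg (by simp [wdeg_zero])]
    · rw [map_sum]
      simp only [map_smul, ht]
      rw [← Fintype.linearCombination_apply,
        map_comp (ε := d) (fun l => by rw [genMap_single]; exact hb l), hp, hga.comp_eq]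
  have hxm : ∀ l, x l ∈ mIdeal K n := fun l => by
    have := hker (x - y) (by rw [map_sub, hxg, hyg, sub_self]) l
    rw [Pi.sub_apply] at this
    exact (Submodule.sub_mem_iff_left _ (hy l)).1 this
  rw [← hxg, comp_genMap hf hxw, genMap, Fintype.linearCombination_apply]
  refine sum_mem fun l _ => ?_
  refine smul_mem_compSub (hin.le ⟨Pi.single l 1, genMap_single _ _⟩) ((hfd l).comp _ _ _)
    (mem_mIdeal.2 ?_) (hxa.comp _ _ _ l)
  rw [coeff_comp, mem_mIdeal.1 (hxm l), ite_self]

/-- If `M` and its initial module have the same number of minimal generators, then `M` has a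
homogeneous minimal generating family whose leading components generate the initial module. -/
theorem exists_minimal_standard_generators (hM : IsGradedSub d M)
    (hbeta : ∀ (res1 : GFRes d M) (res2 : GFRes d (inMod ω ε M)),
      res1.Minimal → res2.Minimal → res1.rk 0 = res2.rk 0) :
    ∃ (r : ℕ) (ε' sh : Fin r → ℕ) (f : Fin r → Fin k → A K n),
      (∀ l, f l ∈ wtLT K ω ε (ε' l + 1)) ∧ (∀ l, Homog 1 d (sh l) (f l)) ∧ (∀ l, f l ∈ M) ∧
      LinearMap.range (genMap (inFam ω ε ε' f)) = inMod ω ε M ∧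
      ∀ x, genMap f x = 0 → ∀ l, x l ∈ mIdeal K n := by
  set S : Set (Fin k → A K n) :=
    {h | ∃ g ∈ M, ∃ a, Homog 1 d a g ∧ ∃ w, g ∈ wtLT K ω ε (w + 1) ∧ h = comp ω ε w g}
  have hspan : Submodule.span (A K n) S = inMod ω ε M := by
    apply le_antisymm
    · rw [Submodule.span_le]
      rintro _ ⟨g, hg, a, -, w, hgw, rfl⟩
      exact comp_mem_inMod hg hgw
    · intro h hh
      refine mem_of_comp_mem 1 d fun a => mem_of_comp_mem ω ε fun w => ?_
      obtain ⟨g, hg, hga, hgw, hgh⟩ := exists_homog_of_mem_inMod hM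
        (isGradedSub_iff.1 (isGradedSub_inMod hM) h hh a) (homog_comp 1 d a h) w
      exact Submodule.subset_span ⟨g, hg, a, hga, w, hgw, hgh.symm⟩
  obtain ⟨r, h, hhS, hh, hmin⟩ := exists_minimal_family S
  choose f hfM sh hfd ε' hfw hfh using id hhS
  obtain rfl : h = inFam ω ε ε' f := funext hfh
  have hin := hh.trans hspan
  have hfd' : ∀ l, Homog 1 d (sh l) (inFam ω ε ε' f l) := fun l => (hfd l).comp _ _ _
  have hfr := range_genMap_eq_of_inMod_le hfw hfM hin.ge
  obtain ⟨res2, hres2, hr2⟩ := exists_minimal_resolution hfd' hin fun x hx =>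
    mem_mIdeal_of_minimal hfd' (fun r' g hg hg' => hmin r' g (fun l => by
      obtain ⟨i, hi⟩ := hg ⟨l, rfl⟩
      exact hi ▸ hhS i) (hg'.trans hh)) hx
  obtain ⟨r₀, f₀, hf₀, hspan₀, hmin₀⟩ := exists_minimal_family (Set.range f)
  choose σ hσ using hf₀
  have hfd₀ : ∀ l, Homog 1 d (sh (σ l)) (f₀ l) := fun l => hσ l ▸ hfd (σ l)
  obtain ⟨res1, hres1, hr1⟩ := exists_minimal_resolution hfd₀
    (hspan₀.trans ((range_genMap f).symm.trans hfr)) fun x hx =>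
    mem_mIdeal_of_minimal hfd₀ (fun r' g hg hg' => hmin₀ r' g (fun l => by
      obtain ⟨i, hi⟩ := hg ⟨l, rfl⟩
      exact hi ▸ ⟨σ i, hσ i⟩) (hg'.trans hspan₀)) hx
  have hr : r = r₀ := by rw [← hr1, ← hr2, hbeta res1 res2 hres1 hres2]
  exact ⟨r, ε', sh, f, hfw, hfd, hfM, hin, fun x hx => mem_mIdeal_of_minimal hfd
    (fun r' g hg hg' => hr ▸ hmin₀ r' g (fun l => hg ⟨l, rfl⟩) (hg'.trans (range_genMap f))) hx⟩

end ComponentwiseLinear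

end CregPaper

namespace CregPaper

/-- **Theorem 5.4.** Let `M ⊆ F` be graded with `in_{(ω,ε)}(M)`
componentwise linear. If `β_0(M) = β_0(in_{(ω,ε)}(M))`, then `M` is
componentwise linear. -/
theorem componentwise_linear_from_beta0
    {K : Type*} [Field K] {n k : ℕ} (ω : Fin n → ℕ) (d ε : Fin k → ℕ)
    (M : Submodule (A K n) (Fin k → A K n)) (hM : IsGradedSub d M)
    (hin : CompLinear d (inMod ω ε M))
    (hbeta : ∀ (res1 : GFRes d M) (res2 : GFRes d (inMod ω ε M)),
      res1.Minimal → res2.Minimal → res1.rk 0 = res2.rk 0) :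
    CompLinear d M := by
  obtain ⟨r, ε', sh, f, hfw, hfd, hfM, hfin, hfker⟩ := exists_minimal_standard_generators hM hbeta
  intro a
  rcases hin a with h0 | hreg
  · left
    refine (Submodule.span_eq_bot).2 fun g hg => eq_zero_of_forall_comp_eq_zero ω ε fun w hgw => ?_
    have hmem := mem_compSub (comp_mem_inMod hg.1 hgw) ((isHomog_iff.1 hg.2).comp ω ε w)
    rwa [h0, Submodule.mem_bot] at hmem
  right
  obtain ⟨m, δ, b, hbM, hba, hbw, hbin, hbker⟩ := exists_leading_generators hM ω ε a
  have hbd : ∀ l, Homog 1 d ((fun _ => a) l) (b l) := hba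
  have hbN : ∀ l, b l ∈ compSub d M a := fun l => mem_compSub (hbM l) (hba l)
  have hbr : LinearMap.range (genMap b) = compSub d M a := by
    refine le_antisymm ?_ (Submodule.span_le.2 fun g hg => ?_)
    · rintro _ ⟨x, rfl⟩
      exact genMap_mem hbN x
    · have hga := isHomog_iff.1 hg.2
      obtain ⟨x, -, -, hx⟩ := exists_lift_homog_wtLT hbw hbd hbM
        (fun w g hg hga hgw => hbin ▸ mem_compSub (comp_mem_inMod hg hgw) (hga.comp _ _ _))
        hg.1 hga (mem_wtLT_maxWt ω ε g)
      exact ⟨x, hx⟩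
  have hsyz := hreg.ker (noneBelow_compSub d _ a) (fun l => (hba l).comp _ _ _) hbin hbker
  have hker : LinearMap.ker (genMap (inFam ω ε δ b)) ≤ inMod ω δ (LinearMap.ker (genMap b)) := by
    rw [← hsyz.compSub_eq (noneBelow_of_mem_mIdeal hbker)]
    refine Submodule.span_le.2 fun s hs => mem_inMod_ker hbw hs.1 fun w hw => ?_
    obtain ⟨x, -, hx⟩ := exists_lift_homog_wtLT hbw hbd hbN
      (fun w g hg hga hgw => hbin ▸
        comp_mem_compSub_inMod hfw hfd hfM hfin hfker hba hbM (hbr ▸ hg) hga hgw)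
      (genMap_mem hbN _)
      (((isHomog_iff.1 hs.2).comp _ _ _).map fun l => by rw [genMap_single]; exact hbd l) hw
    exact ⟨x, hx⟩
  have heq : inMod ω ε (compSub d M a) = compSub d (inMod ω ε M) a := by
    apply le_antisymm
    · rw [← hbr, ← hbin]
      exact inMod_range_le_of_ker_le hbw hker
    · rw [← hbin]
      rintro _ ⟨x, rfl⟩
      exact genMap_mem (fun l => comp_mem_inMod (hbN l) (hbw l)) x
  exact RegLE.of_inMod (isGradedSub_compSub d M a) (noneBelow_compSub d M a) (heq ▸ hreg)

end CregPaper
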